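/- Let (X, μ) be a measure space, Z_ad ⊆ L²(μ) a nonempty set, S : L²(μ) → L²(μ) a map, u_d ∈ L²(μ), α > 0, μ̂ ∈ L²(μ) with μ̂ ≥ 0 a.e., and γ ≥ 1. Define J(z) := (1/2)‖Sz − u_d‖²_{L²(μ)} + (α/2)‖z‖²_{L²(μ)} and J^γ(z) := J(z) + (1/(2γ))‖(μ̂ + γ·Sz)₊‖²_{L²(μ)}. Assume z̄ ∈ Z_ad satisfies S z̄ ≤ 0 a.e., and z̄^γ ∈ Z_ad is a minimizer of J^γ over Z_ad. Then max( ‖S z̄^γ − u_d‖²_{L²(μ)}, α‖z̄^γ‖²_{L²(μ)} ) ≤ 2·( J(z̄) + (1/2)‖μ̂‖²_{L²(μ)} ). -/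

import Mathlib

open MeasureTheory

/-- If `f` is nonnegative and `g` nonpositive, the positive part of `f + g` has norm at most
that of `f`. -/
theorem norm_posPart_add_le_of_nonpos {X : Type*} [MeasurableSpace X] {μ : Measure X}
    {p : ENNReal} {f g : Lp ℝ p μ} (hf : 0 ≤ f) (hg : g ≤ 0) :
    ‖Lp.posPart (f + g)‖ ≤ ‖f‖ := by
  refine Lp.norm_le_norm_of_ae_le ?_
  filter_upwards [Lp.coeFn_posPart (f + g), Lp.coeFn_add f g, (Lp.coeFn_nonneg f).2 hf,
    (Lp.coeFn_le g 0).2 hg, Lp.coeFn_zero ℝ p μ] with x hpos hadd hfx hgx hzero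
  rw [hzero] at hgx
  simp only [Pi.zero_apply, Pi.add_apply] at hadd hfx hgx
  rw [hpos, hadd, Real.norm_of_nonneg (le_max_right _ _), Real.norm_of_nonneg hfx]
  exact max_le (by linarith) hfx

/-- A nonnegative multiple of a nonpositive `Lp` function is nonpositive. -/
theorem Lp_smul_nonpos_of_nonneg_of_nonpos {X : Type*} [MeasurableSpace X] {μ : Measure X}
    {p : ENNReal} {c : ℝ} {g : Lp ℝ p μ} (hc : 0 ≤ c) (hg : g ≤ 0) : c • g ≤ 0 := by
  rw [← Lp.coeFn_le]
  filter_upwards [Lp.coeFn_smul c g, (Lp.coeFn_le g 0).2 hg, Lp.coeFn_zero ℝ p μ]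
    with x hsmul hgx hzero
  rw [hzero] at hgx ⊢
  rw [hsmul]
  exact mul_nonpos_of_nonneg_of_nonpos hc hgx

/-- Uniform (in `γ`) bound on the Moreau–Yosida regularized optimal pair for the quadratic
tracking cost `J(z) = (1/2)‖Sz − u_d‖² + (α/2)‖z‖²`:
`max(‖S z̄^γ − u_d‖², α‖z̄^γ‖²) ≤ 2(J(z̄) + (1/2)‖μ̂‖²)`. -/
theorem moreau_yosida_uniform_bound
    {X : Type*} [MeasurableSpace X] (μ : Measure X)
    (Zad : Set (Lp ℝ 2 μ)) (hZad : Zad.Nonempty)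
    (S : Lp ℝ 2 μ → Lp ℝ 2 μ) (ud : Lp ℝ 2 μ)
    (α : ℝ) (hα : 0 < α)
    (μhat : Lp ℝ 2 μ) (hμhat : 0 ≤ μhat)
    (γ : ℝ) (hγ : 1 ≤ γ)
    (J : Lp ℝ 2 μ → ℝ)
    (hJ : ∀ z, J z = (1 / 2) * ‖S z - ud‖ ^ 2 + (α / 2) * ‖z‖ ^ 2)
    (Jγ : Lp ℝ 2 μ → ℝ)
    (hJγ : ∀ z, Jγ z = J z + (1 / (2 * γ)) * ‖Lp.posPart (μhat + γ • S z)‖ ^ 2)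
    (zbar : Lp ℝ 2 μ) (hzbar : zbar ∈ Zad) (hfeas : S zbar ≤ 0)
    (zγ : Lp ℝ 2 μ) (hzγ : zγ ∈ Zad) (hmin : ∀ z ∈ Zad, Jγ zγ ≤ Jγ z) :
    max (‖S zγ - ud‖ ^ 2) (α * ‖zγ‖ ^ 2) ≤ 2 * (J zbar + (1 / 2) * ‖μhat‖ ^ 2) := by
  have hγ0 : 0 < γ := by linarith
  have h_nonpos : γ • S zbar ≤ 0 := Lp_smul_nonpos_of_nonneg_of_nonpos hγ0.le hfeas
  have h_norm : ‖Lp.posPart (μhat + γ • S zbar)‖ ^ 2 ≤ ‖μhat‖ ^ 2 := by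
    gcongr
    exact norm_posPart_add_le_of_nonpos hμhat h_nonpos
  have h_coeff : 1 / (2 * γ) ≤ 1 / 2 := one_div_le_one_div_of_le two_pos (by linarith)
  have h_penalty : 1 / (2 * γ) * ‖Lp.posPart (μhat + γ • S zbar)‖ ^ 2 ≤ 1 / 2 * ‖μhat‖ ^ 2 := by
    gcongr
  have h_penalty_nonneg : 0 ≤ 1 / (2 * γ) * ‖Lp.posPart (μhat + γ • S zγ)‖ ^ 2 := by positivity
  have h_min := hmin zbar hzbar
  rw [hJγ, hJγ, hJ zγ] at h_min
  have h_state : 0 ≤ ‖S zγ - ud‖ ^ 2 := by positivity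
  have h_control : 0 ≤ α * ‖zγ‖ ^ 2 := by positivity
  exact max_le (by linarith) (by linarith)
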